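/- There exist constants C₁ > 0 and c₁ > 0 such that for all integers n ≥ 1 and m ≥ 1, the probability that |𝔇_{τ_n^𝔅}| ≥ m is at most C₁·exp(−c₁·m²/(m ∨ n)), where m ∨ n denotes max(m,n). -/

import Mathlib

open MeasureTheory ProbabilityTheory Filter

/-- The asymptotic condition `1/w(n) = n^α (1 + 2B/n + O(1/n²))` on the weight function. -/
def WeightAsymp (w : ℕ → ℝ) (α B : ℝ) : Prop :=
  ∃ C₀ > (0:ℝ), ∃ N₀ : ℕ, ∀ n : ℕ, N₀ ≤ n →
    |1 / w n - (n:ℝ) ^ α - 2 * B * (n:ℝ) ^ (α - 1)| ≤ C₀ * (n:ℝ) ^ (α - 2)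

/-- The three admissible choices of `(b, r)` in terms of the weight function `w`. -/
def UrnChoice (w b r : ℕ → ℝ) : Prop :=
  (∀ i, b i = w (2*i) ∧ r i = w (2*i+1)) ∨
  (∀ i, b i = w (2*i+1) ∧ r i = w (2*i)) ∨
  (∀ i, b i = w (2*i) ∧ r i = w (2*i))

/-- A generalized Pólya urn process: `Bl n` and `Re n` are the numbers of blue and red
balls drawn in the first `n` draws; started at `(0,0)`, exactly one coordinate increases
by `1` at each step, and conditionally on the past the blue coordinate increases with
probability `b(Bl n)/(b(Bl n) + r(Re n))`. -/
structure Urn {Ω : Type*} [MeasurableSpace Ω] (μ : Measure Ω) (b r : ℕ → ℝ) where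
  Bl : ℕ → Ω → ℕ
  Re : ℕ → Ω → ℕ
  meas_Bl : ∀ n, Measurable (Bl n)
  meas_Re : ∀ n, Measurable (Re n)
  init_Bl : ∀ ω, Bl 0 ω = 0
  init_Re : ∀ ω, Re 0 ω = 0
  step : ∀ n ω, (Bl (n+1) ω = Bl n ω + 1 ∧ Re (n+1) ω = Re n ω) ∨
                (Bl (n+1) ω = Bl n ω ∧ Re (n+1) ω = Re n ω + 1)
  markov : ∀ n : ℕ,
    μ[(fun ω => if Bl (n+1) ω = Bl n ω + 1 then (1:ℝ) else 0) |
        ⨆ j ∈ Set.Iic n, MeasurableSpace.comap (fun ω => (Bl j ω, Re j ω)) inferInstance]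
      =ᵐ[μ] fun ω => b (Bl n ω) / (b (Bl n ω) + r (Re n ω))

namespace Urn

variable {Ω : Type*} [MeasurableSpace Ω] {μ : Measure Ω} {b r : ℕ → ℝ}

/-- The discrepancy `𝔇_n = ℜ_n − 𝔅_n`. -/
def D (U : Urn μ b r) (n : ℕ) (ω : Ω) : ℤ := (U.Re n ω : ℤ) - (U.Bl n ω : ℤ)

/-- `τ_k^𝔅`, the number of draws until the `k`-th blue ball. -/
noncomputable def tau (U : Urn μ b r) : ℕ → Ω → ℕ
  | 0 => fun _ => 0
  | k+1 => fun ω => sInf {n : ℕ | U.tau k ω < n ∧ U.Bl n ω = U.Bl (n-1) ω + 1}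

/-- The natural filtration `ℱ_n = σ((𝔅_j, ℜ_j), j ≤ n)`. -/
def F (U : Urn μ b r) (n : ℕ) : MeasurableSpace Ω :=
  ⨆ j ∈ Set.Iic n, MeasurableSpace.comap (fun ω => (U.Bl j ω, U.Re j ω)) inferInstance

end Urn

lemma exp_neg_sub_two_mul_sq_le_one_sub {x : ℝ} (h1 : x ≤ 1 / 2) :
    Real.exp (-x - 2 * x ^ 2) ≤ 1 - x := by
  have h := Real.add_one_le_exp (x + 2 * x ^ 2)
  have e : Real.exp (-x - 2 * x ^ 2) * Real.exp (x + 2 * x ^ 2) = 1 := by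
    rw [← Real.exp_add]; simp
  have hx : 1 ≤ (1 - x) * (x + 2 * x ^ 2 + 1) := by nlinarith [sq_nonneg x]
  refine le_of_mul_le_mul_right ?_ (Real.exp_pos (x + 2 * x ^ 2))
  rw [e]
  exact hx.trans (mul_le_mul_of_nonneg_left h (by linarith))

lemma exp_sub_two_mul_sq_le_one_add {x : ℝ} (h0 : 0 ≤ x) :
    Real.exp (x - 2 * x ^ 2) ≤ 1 + x := by
  have h := Real.add_one_le_exp (-x + x ^ 2)
  have e : Real.exp (x - x ^ 2) * Real.exp (-x + x ^ 2) = 1 := by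
    rw [← Real.exp_add]; simp
  have hx : 1 ≤ (1 + x) * (-x + x ^ 2 + 1) := by nlinarith [pow_nonneg h0 3]
  have hle : Real.exp (x - x ^ 2) ≤ 1 + x := by
    refine le_of_mul_le_mul_right ?_ (Real.exp_pos (-x + x ^ 2))
    rw [e]
    exact hx.trans (mul_le_mul_of_nonneg_left h (by linarith))
  exact (Real.exp_le_exp.mpr (by nlinarith [sq_nonneg x])).trans hle

lemma rpow_div_self_le_rpow_sub {α : ℝ} (hα : 0 < α) (n : ℕ) :
    ((n : ℝ) + 1) ^ α / ((n : ℝ) + 1) ≤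
      (1 + α) / α * (((n : ℝ) + 1) ^ α - (n : ℝ) ^ α) := by
  have hn : (0 : ℝ) < (n : ℝ) + 1 := by positivity
  set s : ℝ := 1 / ((n : ℝ) + 1) with hs
  have hs0 : 0 < s := by positivity
  have hs1 : s ≤ 1 := by
    rw [hs, div_le_one hn]; linarith [(Nat.cast_nonneg n : (0 : ℝ) ≤ n)]
  have hsplit : (n : ℝ) ^ α = ((n : ℝ) + 1) ^ α * (1 - s) ^ α := by
    rw [← Real.mul_rpow hn.le (by linarith)]
    congr 1
    rw [hs]; field_simp; ring
  have hexp : (1 - s) ^ α ≤ Real.exp (-(α * s)) := by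
    have h1 : 1 - s ≤ Real.exp (-s) := by linarith [Real.add_one_le_exp (-s)]
    calc (1 - s) ^ α ≤ (Real.exp (-s)) ^ α :=
          Real.rpow_le_rpow (by linarith) h1 hα.le
      _ = Real.exp (-(α * s)) := by rw [← Real.exp_mul]; congr 1; ring
  have hinv : Real.exp (-(α * s)) ≤ 1 / (1 + α * s) := by
    rw [Real.exp_neg, inv_eq_one_div]
    exact one_div_le_one_div_of_le (by positivity) (by linarith [Real.add_one_le_exp (α * s)])
  have hfin : s ≤ (1 + α) / α * (1 - (1 - s) ^ α) := by
    have h2 : α / (1 + α) * s ≤ 1 - 1 / (1 + α * s) := by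
      have : 1 - 1 / (1 + α * s) = α * s / (1 + α * s) := by field_simp; ring
      rw [this, div_mul_eq_mul_div]
      exact div_le_div_of_nonneg_left (by positivity) (by positivity) (by nlinarith)
    have h3 : α / (1 + α) * s ≤ 1 - (1 - s) ^ α := by linarith
    calc s = (1 + α) / α * (α / (1 + α) * s) := by field_simp
      _ ≤ _ := mul_le_mul_of_nonneg_left h3 (by positivity)
  have hp : 0 ≤ ((n : ℝ) + 1) ^ α := by positivity
  rw [hsplit]
  calc ((n : ℝ) + 1) ^ α / ((n : ℝ) + 1) = ((n : ℝ) + 1) ^ α * s := by rw [hs]; ring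
    _ ≤ ((n : ℝ) + 1) ^ α * ((1 + α) / α * (1 - (1 - s) ^ α)) :=
        mul_le_mul_of_nonneg_left hfin hp
    _ = _ := by ring

lemma sum_rpow_div_self_le {α : ℝ} (hα : 0 < α) (n : ℕ) :
    ∑ k ∈ Finset.range n, ((k : ℝ) + 1) ^ α / ((k : ℝ) + 1) ≤ (1 + α) / α * (n : ℝ) ^ α := by
  induction n with
  | zero => simp [Real.zero_rpow hα.ne']
  | succ n ih =>
    rw [Finset.sum_range_succ]
    have := rpow_div_self_le_rpow_sub hα n
    push_cast
    linarith

lemma rpow_succ_sub_le {α : ℝ} (hα : 0 < α) (n : ℕ) :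
    ((n : ℝ) + 1) ^ (α + 1) - (n : ℝ) ^ (α + 1) ≤ (α + 1) * ((n : ℝ) + 1) ^ α := by
  have hn : (0 : ℝ) < (n : ℝ) + 1 := by positivity
  set s : ℝ := 1 / ((n : ℝ) + 1) with hs
  have hs1 : s ≤ 1 := by
    rw [hs, div_le_one hn]; linarith [(Nat.cast_nonneg n : (0 : ℝ) ≤ n)]
  have hsplit : (n : ℝ) ^ (α + 1) = ((n : ℝ) + 1) ^ (α + 1) * (1 + -s) ^ (α + 1) := by
    rw [← Real.mul_rpow hn.le (by linarith)]
    congr 1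
    rw [hs]; field_simp; ring
  have hB := one_add_mul_self_le_rpow_one_add (s := -s) (by linarith) (p := α + 1) (by linarith)
  have hP : ((n : ℝ) + 1) ^ (α + 1) = ((n : ℝ) + 1) ^ α * ((n : ℝ) + 1) :=
    Real.rpow_add_one hn.ne' α
  rw [hsplit]
  calc ((n : ℝ) + 1) ^ (α + 1) - ((n : ℝ) + 1) ^ (α + 1) * (1 + -s) ^ (α + 1)
      ≤ ((n : ℝ) + 1) ^ (α + 1) * ((α + 1) * s) := by
        have : 0 ≤ ((n : ℝ) + 1) ^ (α + 1) := by positivity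
        nlinarith
    _ = _ := by rw [hP, hs]; field_simp

lemma mul_rpow_le_sum_rpow {α : ℝ} (hα : 0 < α) (p m : ℕ) :
    (m : ℝ) * ((p + m : ℕ) : ℝ) ^ α ≤
      (α + 1) * ∑ j ∈ Finset.range m, (((p + j : ℕ) : ℝ) + 1) ^ α := by
  have htel : ((p + m : ℕ) : ℝ) ^ (α + 1) - (p : ℝ) ^ (α + 1) ≤
      (α + 1) * ∑ j ∈ Finset.range m, (((p + j : ℕ) : ℝ) + 1) ^ α := by
    induction m with
    | zero => simp
    | succ m ih =>
      rw [Finset.sum_range_succ, mul_add]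
      have := rpow_succ_sub_le hα (p + m)
      have e : ((p + (m + 1) : ℕ) : ℝ) = ((p + m : ℕ) : ℝ) + 1 := by push_cast; ring
      rw [e]
      linarith
  refine le_trans ?_ htel
  have h1 : ((p + m : ℕ) : ℝ) ^ (α + 1) = ((p + m : ℕ) : ℝ) ^ α * ((p + m : ℕ) : ℝ) :=
    Real.rpow_add_one' (by positivity) (by linarith)
  have h2 : (p : ℝ) ^ (α + 1) = (p : ℝ) ^ α * (p : ℝ) :=
    Real.rpow_add_one' (by positivity) (by linarith)
  have h3 : (p : ℝ) ^ α ≤ ((p + m : ℕ) : ℝ) ^ α :=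
    Real.rpow_le_rpow (by positivity) (by push_cast; linarith [(Nat.cast_nonneg m : (0 : ℝ) ≤ m)])
      hα.le
  have h4 := mul_le_mul_of_nonneg_right h3 (Nat.cast_nonneg (α := ℝ) p)
  rw [h1, h2]
  push_cast at *
  nlinarith

/-- Both rate sequences have reciprocals of order `k ^ α`, and these reciprocals differ by
`O(k ^ (α - 1))`. -/
structure RatesComparable (b r : ℕ → ℝ) (α a A : ℝ) : Prop where
  upper_left : ∀ k : ℕ, 1 / b k ≤ A * ((k : ℝ) + 1) ^ α
  upper_right : ∀ k : ℕ, 1 / r k ≤ A * ((k : ℝ) + 1) ^ α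
  lower_left : ∀ k : ℕ, a * ((k : ℝ) + 1) ^ α ≤ 1 / b k
  lower_right : ∀ k : ℕ, a * ((k : ℝ) + 1) ^ α ≤ 1 / r k
  diff : ∀ k : ℕ, |1 / b k - 1 / r k| ≤ A * (((k : ℝ) + 1) ^ α / ((k : ℝ) + 1))

lemma RatesComparable.symm {b r : ℕ → ℝ} {α a A : ℝ} (h : RatesComparable b r α a A) :
    RatesComparable r b α a A where
  upper_left := h.upper_right
  upper_right := h.upper_left
  lower_left := h.lower_right
  lower_right := h.lower_left
  diff := fun k => by rw [abs_sub_comm]; exact h.diff k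

lemma exp_le_prod_mul_prod {b r : ℕ → ℝ} (hb : ∀ i, 0 < b i) (hr : ∀ i, 0 < r i)
    {α a A ε : ℝ} (hα : 0 < α) (ha : 0 < a) (hA : 0 < A) (h : RatesComparable b r α a A)
    (hε : 0 < ε) (hεA : A * ε ≤ 1 / 2) (hεa : 4 * A ^ 2 * ε ≤ a / (2 * (α + 1)))
    (p m : ℕ) (hm : 1 ≤ m) {t : ℝ} (ht : t = ε * m / ((p + m : ℕ) : ℝ) ^ (α + 1)) :
    (∀ k ≤ p, t / b k ≤ 1 / 2) ∧
    Real.exp (ε * a / (2 * (α + 1)) * (m : ℝ) ^ 2 / ((p + m : ℕ) : ℝ) -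
        A * ((1 + α) / α) * ε) ≤
      (∏ k ∈ Finset.range p, (1 - t / b k)) * ∏ k ∈ Finset.range (p + m), (1 + t / r k) := by
  have hm' : (1 : ℝ) ≤ m := by exact_mod_cast hm
  obtain ⟨N, hN⟩ : ∃ N : ℝ, N = ((p + m : ℕ) : ℝ) := ⟨_, rfl⟩
  have hmN : (m : ℝ) ≤ N := by rw [hN]; push_cast; linarith [(Nat.cast_nonneg p : (0 : ℝ) ≤ p)]
  have hN0 : 0 < N := by linarith
  have hNα : 0 < N ^ α := by positivity
  rw [← hN] at ht
  rw [← hN]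
  rw [Real.rpow_add_one hN0.ne'] at ht
  have ht0 : 0 < t := by rw [ht]; positivity
  have htN : t * N ^ α = ε * (m / N) := by rw [ht]; field_simp
  have hmN1 : (m : ℝ) / N ≤ 1 := by rw [div_le_one hN0]; exact hmN
  have hmN0 : 0 ≤ (m : ℝ) / N := by positivity
  have hP : ∀ k : ℕ, k < p + m → ((k : ℝ) + 1) ^ α ≤ N ^ α := fun k hk =>
    Real.rpow_le_rpow (by positivity) (by rw [hN]; exact_mod_cast hk) hα.le
  have hdb : ∀ k : ℕ, t / b k = t * (1 / b k) := fun k => by ring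
  have hdr : ∀ k : ℕ, t / r k = t * (1 / r k) := fun k => by ring
  have hub : ∀ k : ℕ, k < p + m → t / b k ≤ A * ε * (m / N) := fun k hk => by
    rw [hdb]
    calc t * (1 / b k) ≤ t * (A * N ^ α) := mul_le_mul_of_nonneg_left
          ((h.upper_left k).trans (mul_le_mul_of_nonneg_left (hP k hk) hA.le)) ht0.le
      _ = A * (t * N ^ α) := by ring
      _ = _ := by rw [htN]; ring
  have hur : ∀ k : ℕ, k < p + m → t / r k ≤ A * ε * (m / N) := fun k hk => by
    rw [hdr]
    calc t * (1 / r k) ≤ t * (A * N ^ α) := mul_le_mul_of_nonneg_left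
          ((h.upper_right k).trans (mul_le_mul_of_nonneg_left (hP k hk) hA.le)) ht0.le
      _ = A * (t * N ^ α) := by ring
      _ = _ := by rw [htN]; ring
  have hhalf : ∀ k ≤ p, t / b k ≤ 1 / 2 := fun k hk => by
    refine (hub k (by omega)).trans ?_
    have : 0 < A * ε := by positivity
    nlinarith
  refine ⟨hhalf, ?_⟩
  have hb0 : ∀ k, 0 ≤ t / b k := fun k => by have := hb k; positivity
  have hr0 : ∀ k, 0 ≤ t / r k := fun k => by have := hr k; positivity
  set Q : ℝ := (A * ε * (m / N)) ^ 2 with hQ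
  have hpb : Real.exp (∑ k ∈ Finset.range p, (-(t / b k) - 2 * Q)) ≤
      ∏ k ∈ Finset.range p, (1 - t / b k) := by
    rw [Real.exp_sum]
    refine Finset.prod_le_prod (fun _ _ => (Real.exp_pos _).le) fun k hk => ?_
    have hk := Finset.mem_range.mp hk
    refine le_trans (Real.exp_le_exp.mpr ?_)
      (exp_neg_sub_two_mul_sq_le_one_sub (hhalf k hk.le))
    have : (t / b k) ^ 2 ≤ Q := pow_le_pow_left₀ (hb0 k) (hub k (by omega)) 2
    linarith
  have hpr : Real.exp (∑ k ∈ Finset.range (p + m), (t / r k - 2 * Q)) ≤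
      ∏ k ∈ Finset.range (p + m), (1 + t / r k) := by
    rw [Real.exp_sum]
    refine Finset.prod_le_prod (fun _ _ => (Real.exp_pos _).le) fun k hk => ?_
    have hk := Finset.mem_range.mp hk
    refine le_trans (Real.exp_le_exp.mpr ?_) (exp_sub_two_mul_sq_le_one_add (hr0 k))
    have : (t / r k) ^ 2 ≤ Q := pow_le_pow_left₀ (hr0 k) (hur k hk) 2
    linarith
  refine le_trans ?_ (mul_le_mul hpb hpr (Real.exp_pos _).le
    ((Real.exp_pos _).le.trans hpb))
  rw [← Real.exp_add, Real.exp_le_exp, Finset.sum_range_add, ← add_assoc,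
    ← Finset.sum_add_distrib]
  have hlow1 : -(∑ k ∈ Finset.range p, (t * (A * (((k : ℝ) + 1) ^ α / ((k : ℝ) + 1))) + 4 * Q)) ≤
      ∑ k ∈ Finset.range p, (-(t / b k) - 2 * Q + (t / r k - 2 * Q)) := by
    rw [← Finset.sum_neg_distrib]
    refine Finset.sum_le_sum fun k _ => ?_
    have h1 := mul_le_mul_of_nonneg_left ((le_abs_self _).trans (h.diff k)) ht0.le
    have h2 := hdb k
    have h3 := hdr k
    linarith
  have hlow2 : ∑ j ∈ Finset.range m, (t * (a * (((p + j : ℕ) : ℝ) + 1) ^ α) - 2 * Q) ≤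
      ∑ j ∈ Finset.range m, (t / r (p + j) - 2 * Q) := by
    refine Finset.sum_le_sum fun j _ => ?_
    have h1 := mul_le_mul_of_nonneg_left (h.lower_right (p + j)) ht0.le
    have h3 := hdr (p + j)
    linarith
  refine le_trans ?_ (add_le_add hlow1 hlow2)
  rw [Finset.sum_add_distrib, Finset.sum_sub_distrib]
  simp only [← Finset.mul_sum, Finset.sum_const, Finset.card_range, nsmul_eq_mul]
  have hS1 := sum_rpow_div_self_le hα p
  have hS2 := mul_rpow_le_sum_rpow hα p m
  rw [← hN] at hS2
  have hpN : (p : ℝ) ^ α ≤ N ^ α := Real.rpow_le_rpow (by positivity)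
    (by rw [hN]; push_cast; linarith) hα.le
  have hpm : (p : ℝ) + m = N := by rw [hN]; push_cast; ring
  have hT1 : t * (A * ∑ k ∈ Finset.range p, ((k : ℝ) + 1) ^ α / ((k : ℝ) + 1)) ≤
      A * ((1 + α) / α) * ε := by
    calc _ ≤ t * (A * ((1 + α) / α * N ^ α)) := by
          have : (1 + α) / α * (p : ℝ) ^ α ≤ (1 + α) / α * N ^ α :=
            mul_le_mul_of_nonneg_left hpN (by positivity)
          gcongr
          exact hS1.trans this
      _ = A * ((1 + α) / α) * (t * N ^ α) := by ring
      _ = A * ((1 + α) / α) * ε * (m / N) := by rw [htN]; ring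
      _ ≤ _ := mul_le_of_le_one_right (by positivity) hmN1
  have hT2 : ε * a / (α + 1) * ((m : ℝ) ^ 2 / N) ≤
      t * (a * ∑ j ∈ Finset.range m, (((p + j : ℕ) : ℝ) + 1) ^ α) := by
    calc ε * a / (α + 1) * ((m : ℝ) ^ 2 / N) = a / (α + 1) * m * (ε * (m / N)) := by ring
      _ = t * (a * ((m * N ^ α) / (α + 1))) := by rw [← htN]; ring
      _ ≤ _ := by
        gcongr
        rw [div_le_iff₀ (by positivity)]
        linarith
  have hT3 : (p : ℝ) * (4 * Q) + m * (2 * Q) ≤ ε * a / (2 * (α + 1)) * ((m : ℝ) ^ 2 / N) := by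
    have hQ0 : 0 ≤ Q := sq_nonneg _
    calc (p : ℝ) * (4 * Q) + m * (2 * Q) ≤ 4 * N * Q := by nlinarith
      _ = ε * (4 * A ^ 2 * ε) * ((m : ℝ) ^ 2 / N) := by rw [hQ]; field_simp
      _ ≤ ε * (a / (2 * (α + 1))) * ((m : ℝ) ^ 2 / N) := by gcongr
      _ = _ := by ring
  have e1 : ε * a / (2 * (α + 1)) * (m : ℝ) ^ 2 / N =
      ε * a / (α + 1) * ((m : ℝ) ^ 2 / N) - ε * a / (2 * (α + 1)) * ((m : ℝ) ^ 2 / N) := by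
    field_simp; ring
  rw [e1]
  linarith

/-- The one-step superharmonicity inequality for the urn with rates `b` and `r`. -/
def UrnSuperharmonic (b r : ℕ → ℝ) (g : ℕ → ℕ → ℝ) : Prop :=
  ∀ i j, b i * g (i + 1) j + r j * g i (j + 1) ≤ (b i + r j) * g i j

lemma exists_urnSuperharmonic {b r : ℕ → ℝ} (hb : ∀ i, 0 < b i) (hr : ∀ i, 0 < r i)
    {α a A : ℝ} (hα : 0 < α) (ha : 0 < a) (hA : 0 < A) (h : RatesComparable b r α a A) :
    ∃ C > (0 : ℝ), ∃ c > (0 : ℝ), ∀ p m : ℕ, 1 ≤ m → ∃ g : ℕ → ℕ → ℝ,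
      (∀ i j, 0 ≤ g i j) ∧ g 0 0 = 1 ∧ UrnSuperharmonic b r g ∧
      ∀ i j, i ≤ p → p + m ≤ j →
        1 ≤ C * Real.exp (-c * (m : ℝ) ^ 2 / ((p + m : ℕ) : ℝ)) * g i j := by
  obtain ⟨ε, hε, hεA, hεa⟩ : ∃ ε : ℝ, 0 < ε ∧ A * ε ≤ 1 / 2 ∧
      4 * A ^ 2 * ε ≤ a / (2 * (α + 1)) := by
    refine ⟨min (1 / (2 * A)) (a / (2 * (α + 1)) / (4 * A ^ 2)), by positivity, ?_, ?_⟩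
    · refine (mul_le_mul_of_nonneg_left (min_le_left _ _) hA.le).trans (le_of_eq ?_)
      field_simp
    · refine (mul_le_mul_of_nonneg_left (min_le_right _ _) (by positivity)).trans (le_of_eq ?_)
      field_simp
  refine ⟨Real.exp (A * ((1 + α) / α) * ε), Real.exp_pos _, ε * a / (2 * (α + 1)),
    by positivity, fun p m hm => ?_⟩
  obtain ⟨hhalf, hprod⟩ := exp_le_prod_mul_prod hb hr hα ha hA h hε hεA hεa p m hm rfl
  obtain ⟨t, ht⟩ : ∃ t : ℝ, t = ε * m / ((p + m : ℕ) : ℝ) ^ (α + 1) := ⟨_, rfl⟩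
  rw [← ht] at hhalf hprod
  have ht0 : 0 ≤ t := by rw [ht]; positivity
  have hb0 : ∀ k, 0 ≤ t / b k := fun k => by have := hb k; positivity
  have hr0 : ∀ k, 0 ≤ t / r k := fun k => by have := hr k; positivity
  have hX0 : ∀ i ≤ p + 1, 0 ≤ ∏ k ∈ Finset.range i, (1 - t / b k) := fun i hi =>
    Finset.prod_nonneg fun k hk => by
      have := hhalf k (by have := Finset.mem_range.mp hk; omega)
      linarith
  have hY0 : ∀ j, 0 ≤ ∏ k ∈ Finset.range j, (1 + t / r k) := fun j =>
    Finset.prod_nonneg fun k _ => by have := hr0 k; linarith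
  refine ⟨fun i j => if i ≤ p then
    (∏ k ∈ Finset.range i, (1 - t / b k)) * ∏ k ∈ Finset.range j, (1 + t / r k) else 0,
    fun i j => ?_, by simp, fun i j => ?_, fun i j hi hj => ?_⟩
  · dsimp only
    split_ifs with hi
    · exact mul_nonneg (hX0 i (by omega)) (hY0 j)
    · exact le_rfl
  · dsimp only
    by_cases hi : i ≤ p
    · have hle : (if i + 1 ≤ p then (∏ k ∈ Finset.range (i + 1), (1 - t / b k)) *
          ∏ k ∈ Finset.range j, (1 + t / r k) else 0) ≤
          (∏ k ∈ Finset.range (i + 1), (1 - t / b k)) * ∏ k ∈ Finset.range j, (1 + t / r k) := by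
        split_ifs
        · exact le_rfl
        · exact mul_nonneg (hX0 (i + 1) (by omega)) (hY0 j)
      refine (add_le_add_left (mul_le_mul_of_nonneg_left hle (hb i).le) _).trans (le_of_eq ?_)
      rw [if_pos hi, if_pos hi, Finset.prod_range_succ, Finset.prod_range_succ _ j]
      have := (hb i).ne'
      have := (hr j).ne'
      field_simp
      ring
    · rw [if_neg (by omega), if_neg hi, if_neg hi]
      simp
  · dsimp only
    rw [if_pos hi]
    have hX : ∏ k ∈ Finset.range p, (1 - t / b k) ≤ ∏ k ∈ Finset.range i, (1 - t / b k) := by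
      refine Finset.prod_le_prod_of_subset_of_le_one (Finset.range_mono hi) (fun k hk => ?_)
        fun k hk _ => ?_
      · have := hhalf k (Finset.mem_range.mp hk).le
        linarith
      · linarith [hb0 k]
    have hY : ∏ k ∈ Finset.range (p + m), (1 + t / r k) ≤
        ∏ k ∈ Finset.range j, (1 + t / r k) := by
      refine Finset.prod_le_prod_of_subset_of_one_le (Finset.range_mono hj) (fun k _ => ?_)
        fun k _ _ => ?_ <;> linarith [hr0 k]
    have := hprod.trans (mul_le_mul hX hY (hY0 _) (hX0 i (by omega)))
    refine le_trans (le_of_eq ?_) (mul_le_mul_of_nonneg_left this (by positivity))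
    rw [← Real.exp_add, ← Real.exp_add, eq_comm, Real.exp_eq_one_iff]
    ring

lemma exists_forall_le_of_forall_ge {f : ℕ → ℝ} (hf : ∀ n, 0 ≤ f n) {N : ℕ} {C : ℝ}
    (h : ∀ n, N ≤ n → f n ≤ C) : ∃ K > (0 : ℝ), ∀ n, f n ≤ K := by
  refine ⟨|C| + 1 + ∑ k ∈ Finset.range N, f k, ?_, fun n => ?_⟩
  · have := Finset.sum_nonneg fun k (_ : k ∈ Finset.range N) => hf k
    positivity
  · by_cases hn : N ≤ n
    · have := Finset.sum_nonneg fun k (_ : k ∈ Finset.range N) => hf k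
      linarith [h n hn, le_abs_self C]
    · have := Finset.single_le_sum (fun k _ => hf k) (Finset.mem_range.mpr (not_le.mp hn))
      linarith [abs_nonneg C]

lemma natCast_rpow_bounds {α : ℝ} (hα : 0 < α) {n : ℕ} (hn : 1 ≤ n) :
    (n : ℝ) ^ α ≤ ((n : ℝ) + 1) ^ α ∧ ((n : ℝ) + 1) ^ α ≤ 2 ^ α * (n : ℝ) ^ α ∧
    (n : ℝ) ^ α / n ≤ 2 * (((n : ℝ) + 1) ^ α / ((n : ℝ) + 1)) ∧
    ((n : ℝ) + 1) ^ α - (n : ℝ) ^ α ≤ 2 * α * (((n : ℝ) + 1) ^ α / ((n : ℝ) + 1)) := by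
  have hn1 : (1 : ℝ) ≤ n := by exact_mod_cast hn
  have hn0 : (0 : ℝ) < (n : ℝ) + 1 := by positivity
  have hmono : (n : ℝ) ^ α ≤ ((n : ℝ) + 1) ^ α :=
    Real.rpow_le_rpow (by positivity) (by linarith) hα.le
  refine ⟨hmono, ?_, ?_, ?_⟩
  · rw [← Real.mul_rpow (by norm_num) (by positivity)]
    exact Real.rpow_le_rpow (by positivity) (by linarith) hα.le
  · have h1 : (n : ℝ) ^ α / n ≤ ((n : ℝ) + 1) ^ α / n := by gcongr
    have h2 : ((n : ℝ) + 1) ^ α / n ≤ 2 * (((n : ℝ) + 1) ^ α / ((n : ℝ) + 1)) := by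
      rw [← mul_div_assoc, div_le_div_iff₀ (by linarith) hn0]
      have : 0 < ((n : ℝ) + 1) ^ α := by positivity
      nlinarith
    exact h1.trans h2
  · set s : ℝ := 1 / ((n : ℝ) + 1) with hs
    have hs0 : 0 < s := by positivity
    have hs1 : s ≤ 1 / 2 := one_div_le_one_div_of_le (by norm_num) (by linarith)
    have hsplit : (n : ℝ) ^ α = ((n : ℝ) + 1) ^ α * (1 - s) ^ α := by
      rw [← Real.mul_rpow hn0.le (by linarith)]
      congr 1
      rw [hs]; field_simp; ring
    have h1 : 1 - 2 * α * s ≤ (1 - s) ^ α := by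
      calc 1 - 2 * α * s ≤ (-s - 2 * s ^ 2) * α + 1 := by
            have : s ^ 2 * α ≤ s * (1 / 2) * α := by rw [pow_two]; gcongr
            nlinarith
        _ ≤ Real.exp ((-s - 2 * s ^ 2) * α) := Real.add_one_le_exp _
        _ = Real.exp (-s - 2 * s ^ 2) ^ α := Real.exp_mul _ _
        _ ≤ (1 - s) ^ α := Real.rpow_le_rpow (Real.exp_pos _).le
            (exp_neg_sub_two_mul_sq_le_one_sub hs1) hα.le
    have hP : 0 < ((n : ℝ) + 1) ^ α := by positivity
    have e : 2 * α * (((n : ℝ) + 1) ^ α / ((n : ℝ) + 1)) =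
        ((n : ℝ) + 1) ^ α * (2 * α * s) := by rw [hs]; ring
    rw [e, hsplit]
    nlinarith

lemma WeightAsymp.exists_bounds {w : ℕ → ℝ} {α B : ℝ} (hα : 0 < α) (hw : ∀ n, 0 < w n)
    (h : WeightAsymp w α B) :
    ∃ a > (0 : ℝ), ∃ A > (0 : ℝ), ∀ n : ℕ, a * ((n : ℝ) + 1) ^ α ≤ 1 / w n ∧
      1 / w n ≤ A * ((n : ℝ) + 1) ^ α ∧
      |1 / w n - 1 / w (n + 1)| ≤ A * (((n : ℝ) + 1) ^ α / ((n : ℝ) + 1)) := by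
  obtain ⟨C₀, hC₀, N₀, hN⟩ := h
  set D : ℝ := 2 * |B| + C₀ with hD
  have hD0 : 0 < D := by positivity
  obtain ⟨N, hN1, hN2, hN3⟩ : ∃ N : ℕ, N₀ ≤ N ∧ 1 ≤ N ∧ 2 * D ≤ N := by
    obtain ⟨K, hK⟩ := exists_nat_ge (2 * D)
    refine ⟨N₀ + 1 + K, by omega, by omega, hK.trans ?_⟩
    push_cast
    linarith [(Nat.cast_nonneg N₀ : (0 : ℝ) ≤ N₀)]
  have hx : ∀ n : ℕ, N ≤ n → |1 / w n - (n : ℝ) ^ α| ≤ D * ((n : ℝ) ^ α / n) := by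
    intro n hn
    have hn1 : (1 : ℝ) ≤ n := by exact_mod_cast hN2.trans hn
    have h1 := hN n (hN1.trans hn)
    have e1 : (n : ℝ) ^ (α - 1) = (n : ℝ) ^ α / n := Real.rpow_sub_one (by positivity) α
    have e2 : (n : ℝ) ^ (α - 2) ≤ (n : ℝ) ^ (α - 1) :=
      Real.rpow_le_rpow_of_exponent_le hn1 (by linarith)
    rw [← e1]
    have h2 : |2 * B * (n : ℝ) ^ (α - 1)| = 2 * |B| * (n : ℝ) ^ (α - 1) := by
      rw [abs_mul, abs_mul, abs_of_pos (by positivity : (0 : ℝ) < (n : ℝ) ^ (α - 1))]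
      norm_num
    have h3 := abs_add_le (1 / w n - (n : ℝ) ^ α - 2 * B * (n : ℝ) ^ (α - 1))
      (2 * B * (n : ℝ) ^ (α - 1))
    rw [sub_add_cancel, h2] at h3
    have h4 := mul_le_mul_of_nonneg_left e2 hC₀.le
    rw [hD]
    linarith
  have hw' : ∀ n, 0 < 1 / w n := fun n => by have := hw n; positivity
  have hP : ∀ n : ℕ, 0 < ((n : ℝ) + 1) ^ α := fun n => by positivity
  obtain ⟨K₁, hK₁, h₁⟩ := exists_forall_le_of_forall_ge
    (f := fun n : ℕ => (1 / w n) / ((n : ℝ) + 1) ^ α) (N := N) (C := 1 + D)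
    (fun n => (div_pos (hw' n) (hP n)).le) (fun n hn => by
      have hn1 : (1 : ℝ) ≤ n := by exact_mod_cast hN2.trans hn
      rw [div_le_iff₀ (hP n)]
      have h1 := (abs_le.mp (hx n hn)).2
      have h2 := (natCast_rpow_bounds hα (hN2.trans hn)).1
      have h3 : (n : ℝ) ^ α / n ≤ (n : ℝ) ^ α := div_le_self (by positivity) hn1
      have h4 := mul_le_mul_of_nonneg_left (h3.trans h2) hD0.le
      linarith)
  obtain ⟨K₂, hK₂, h₂⟩ := exists_forall_le_of_forall_ge
    (f := fun n : ℕ => ((n : ℝ) + 1) ^ α / (1 / w n)) (N := N) (C := 2 * 2 ^ α)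
    (fun n => (div_pos (hP n) (hw' n)).le) (fun n hn => by
      have hn1 : (1 : ℝ) ≤ n := by exact_mod_cast hN2.trans hn
      have hnN : (N : ℝ) ≤ n := by exact_mod_cast hn
      rw [div_le_iff₀ (hw' n)]
      have h1 := (abs_le.mp (hx n hn)).1
      have h2 := (natCast_rpow_bounds hα (hN2.trans hn)).2.1
      have h3 : D * ((n : ℝ) ^ α / n) ≤ (n : ℝ) ^ α / 2 := by
        have : 0 < (n : ℝ) ^ α := by positivity
        rw [← mul_div_assoc, div_le_div_iff₀ (by linarith) (by norm_num)]
        nlinarith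
      have h4 : (n : ℝ) ^ α ≤ 2 * (1 / w n) := by linarith
      have h5 := mul_le_mul_of_nonneg_left h4 (by positivity : (0 : ℝ) ≤ 2 ^ α)
      linarith)
  obtain ⟨K₃, hK₃, h₃⟩ := exists_forall_le_of_forall_ge
    (f := fun n : ℕ => |1 / w n - 1 / w (n + 1)| / (((n : ℝ) + 1) ^ α / ((n : ℝ) + 1)))
    (N := N) (C := 2 * α + 3 * D) (fun n => by positivity) (fun n hn => by
      rw [div_le_iff₀ (by positivity)]
      obtain ⟨b1, -, b3, b4⟩ := natCast_rpow_bounds hα (hN2.trans hn)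
      have h1 := abs_le.mp (hx n hn)
      have h2 := abs_le.mp (hx (n + 1) (by omega))
      push_cast at h2
      have h3 := mul_le_mul_of_nonneg_left b3 hD0.le
      rw [abs_le]
      have h0 : 0 ≤ α * (((n : ℝ) + 1) ^ α / ((n : ℝ) + 1)) := by positivity
      constructor <;> linarith [h1.1, h1.2, h2.1, h2.2])
  refine ⟨1 / K₂, by positivity, max K₁ K₃, by positivity, fun n => ⟨?_, ?_, ?_⟩⟩
  · have := (div_le_iff₀ (hw' n)).mp (h₂ n)
    rw [div_mul_eq_mul_div, one_mul, div_le_iff₀ hK₂]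
    linarith
  · exact ((div_le_iff₀ (hP n)).mp (h₁ n)).trans
      (mul_le_mul_of_nonneg_right (le_max_left _ _) (hP n).le)
  · exact ((div_le_iff₀ (by positivity)).mp (h₃ n)).trans
      (mul_le_mul_of_nonneg_right (le_max_right _ _) (by positivity))

lemma UrnChoice.exists_ratesComparable {w b r : ℕ → ℝ} {α B : ℝ} (hα : 0 < α)
    (hw : ∀ n, 0 < w n) (h : WeightAsymp w α B) (hc : UrnChoice w b r) :
    ∃ a > (0 : ℝ), ∃ A > (0 : ℝ), RatesComparable b r α a A := by
  obtain ⟨a, ha, A, hA, H⟩ := h.exists_bounds hα hw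
  have heven : ∀ k : ℕ, a * ((k : ℝ) + 1) ^ α ≤ 1 / w (2 * k) ∧
      1 / w (2 * k) ≤ A * 2 ^ α * ((k : ℝ) + 1) ^ α ∧
      |1 / w (2 * k) - 1 / w (2 * k + 1)| ≤ A * 2 ^ α * (((k : ℝ) + 1) ^ α / ((k : ℝ) + 1)) := by
    intro k
    obtain ⟨h1, h2, h3⟩ := H (2 * k)
    push_cast at h1 h2 h3
    have hk : (0 : ℝ) ≤ k := Nat.cast_nonneg k
    have hl : ((k : ℝ) + 1) ^ α ≤ (2 * (k : ℝ) + 1) ^ α :=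
      Real.rpow_le_rpow (by positivity) (by linarith) hα.le
    have hu : (2 * (k : ℝ) + 1) ^ α ≤ 2 ^ α * ((k : ℝ) + 1) ^ α := by
      rw [← Real.mul_rpow (by norm_num) (by positivity)]
      exact Real.rpow_le_rpow (by positivity) (by linarith) hα.le
    refine ⟨(mul_le_mul_of_nonneg_left hl ha.le).trans h1, h2.trans ?_, h3.trans ?_⟩
    · rw [mul_assoc]
      exact mul_le_mul_of_nonneg_left hu hA.le
    · rw [mul_assoc]
      refine mul_le_mul_of_nonneg_left ?_ hA.le
      rw [← mul_div_assoc]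
      exact div_le_div₀ (by positivity) hu (by positivity) (by linarith)
  have hodd : ∀ k : ℕ, a * ((k : ℝ) + 1) ^ α ≤ 1 / w (2 * k + 1) ∧
      1 / w (2 * k + 1) ≤ A * 2 ^ α * ((k : ℝ) + 1) ^ α := by
    intro k
    obtain ⟨h1, h2, -⟩ := H (2 * k + 1)
    push_cast at h1 h2
    have hk : (0 : ℝ) ≤ k := Nat.cast_nonneg k
    have e : (2 * (k : ℝ) + 1 + 1) ^ α = 2 ^ α * ((k : ℝ) + 1) ^ α := by
      rw [← Real.mul_rpow (by norm_num) (by positivity)]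
      congr 1
      ring
    have hl : ((k : ℝ) + 1) ^ α ≤ (2 * (k : ℝ) + 1 + 1) ^ α :=
      Real.rpow_le_rpow (by positivity) (by linarith) hα.le
    refine ⟨(mul_le_mul_of_nonneg_left hl ha.le).trans h1, h2.trans (le_of_eq ?_)⟩
    rw [e, mul_assoc]
  refine ⟨a, ha, A * 2 ^ α, by positivity, ?_⟩
  have hfirst : ∀ {b r : ℕ → ℝ}, (∀ i, b i = w (2 * i) ∧ r i = w (2 * i + 1)) →
      RatesComparable b r α a (A * 2 ^ α) := fun {b r} hbr =>
    { upper_left := fun k => by rw [(hbr k).1]; exact (heven k).2.1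
      upper_right := fun k => by rw [(hbr k).2]; exact (hodd k).2
      lower_left := fun k => by rw [(hbr k).1]; exact (heven k).1
      lower_right := fun k => by rw [(hbr k).2]; exact (hodd k).1
      diff := fun k => by rw [(hbr k).1, (hbr k).2]; exact (heven k).2.2 }
  rcases hc with hc | hc | hc
  · exact hfirst hc
  · exact (hfirst fun i => (hc i).symm).symm
  · exact
      { upper_left := fun k => by rw [(hc k).1]; exact (heven k).2.1
        upper_right := fun k => by rw [(hc k).2]; exact (heven k).2.1
        lower_left := fun k => by rw [(hc k).1]; exact (heven k).1
        lower_right := fun k => by rw [(hc k).2]; exact (heven k).1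
        diff := fun k => by rw [(hc k).1, (hc k).2, sub_self, abs_zero]; positivity }

namespace Urn

variable {Ω : Type*} [MeasurableSpace Ω] {μ : Measure Ω} {b r : ℕ → ℝ}

lemma Bl_add_Re (U : Urn μ b r) (t : ℕ) (ω : Ω) : U.Bl t ω + U.Re t ω = t := by
  induction t with
  | zero => rw [U.init_Bl, U.init_Re]
  | succ t ih => rcases U.step t ω with h | h <;> omega

lemma Bl_mono (U : Urn μ b r) (ω : Ω) : Monotone fun t => U.Bl t ω :=
  monotone_nat_of_le_succ fun t => by rcases U.step t ω with h | h <;> omega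

lemma Re_mono (U : Urn μ b r) (ω : Ω) : Monotone fun t => U.Re t ω :=
  monotone_nat_of_le_succ fun t => by rcases U.step t ω with h | h <;> omega

lemma F_le (U : Urn μ b r) (t : ℕ) : U.F t ≤ ‹MeasurableSpace Ω› :=
  iSup₂_le fun j _ => ((U.meas_Bl j).prodMk (U.meas_Re j)).comap_le

lemma stronglyMeasurable_F (U : Urn μ b r) (h : ℕ → ℕ → ℝ) (t : ℕ) :
    StronglyMeasurable[U.F t] fun ω => h (U.Bl t ω) (U.Re t ω) := by
  have hpair : Measurable[U.F t] fun ω => (U.Bl t ω, U.Re t ω) := by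
    have hle : MeasurableSpace.comap (fun ω => (U.Bl t ω, U.Re t ω)) inferInstance ≤ U.F t :=
      le_iSup₂ (f := fun j (_ : j ∈ Set.Iic t) =>
        MeasurableSpace.comap (fun ω => (U.Bl j ω, U.Re j ω)) inferInstance) t Set.self_mem_Iic
    exact (comap_measurable _).mono hle le_rfl
  exact ((measurable_of_countable fun x : ℕ × ℕ => h x.1 x.2).comp hpair).stronglyMeasurable

lemma integrable_comp [IsProbabilityMeasure μ] (U : Urn μ b r) (h : ℕ → ℕ → ℝ) (t : ℕ) :
    Integrable (fun ω => h (U.Bl t ω) (U.Re t ω)) μ := by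
  refine Integrable.of_bound
    ((U.stronglyMeasurable_F h t).mono (U.F_le t)).aestronglyMeasurable
    (∑ i ∈ Finset.range (t + 1), ∑ j ∈ Finset.range (t + 1), |h i j|) (ae_of_all _ fun ω => ?_)
  have ht := U.Bl_add_Re t ω
  rw [Real.norm_eq_abs]
  refine le_trans ?_ (Finset.single_le_sum (f := fun i => ∑ j ∈ Finset.range (t + 1), |h i j|)
    (fun i _ => Finset.sum_nonneg fun j _ => abs_nonneg _)
    (Finset.mem_range.mpr (by omega : U.Bl t ω < t + 1)))
  exact Finset.single_le_sum (f := fun j => |h (U.Bl t ω) j|) (fun j _ => abs_nonneg _)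
    (Finset.mem_range.mpr (by omega : U.Re t ω < t + 1))

lemma integral_urnSuperharmonic_le [IsProbabilityMeasure μ] (U : Urn μ b r)
    (hb : ∀ i, 0 < b i) (hr : ∀ i, 0 < r i) {g : ℕ → ℕ → ℝ} (hg : UrnSuperharmonic b r g)
    (t : ℕ) : ∫ ω, g (U.Bl t ω) (U.Re t ω) ∂μ ≤ g 0 0 := by
  induction t with
  | zero => simp [U.init_Bl, U.init_Re]
  | succ t ih =>
    refine le_trans ?_ ih
    set X : Ω → ℝ := fun ω => if U.Bl (t + 1) ω = U.Bl t ω + 1 then (1 : ℝ) else 0 with hX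
    set G : Ω → ℝ := fun ω =>
      g (U.Bl t ω + 1) (U.Re t ω) - g (U.Bl t ω) (U.Re t ω + 1) with hG
    set q : Ω → ℝ := fun ω => b (U.Bl t ω) / (b (U.Bl t ω) + r (U.Re t ω)) with hq
    have hGm : StronglyMeasurable[U.F t] G :=
      U.stronglyMeasurable_F (fun i j => g (i + 1) j - g i (j + 1)) t
    have hGi : Integrable G μ := U.integrable_comp (fun i j => g (i + 1) j - g i (j + 1)) t
    have hXm : Measurable X := Measurable.ite
      (measurableSet_eq_fun (U.meas_Bl (t + 1)) ((U.meas_Bl t).add_const 1))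
      measurable_const measurable_const
    have hXb : ∀ ω, ‖X ω‖ ≤ 1 := fun ω => by
      rw [hX]; dsimp only; split_ifs <;> simp
    have hXi : Integrable X μ := Integrable.of_bound hXm.aestronglyMeasurable 1
      (ae_of_all _ hXb)
    have hGXi : Integrable (G * X) μ := hGi.mul_bdd hXm.aestronglyMeasurable (ae_of_all _ hXb)
    have hRi : Integrable (fun ω => g (U.Bl t ω) (U.Re t ω + 1)) μ :=
      U.integrable_comp (fun i j => g i (j + 1)) t
    have hGqi : Integrable (G * q) μ :=
      U.integrable_comp (fun i j => (g (i + 1) j - g i (j + 1)) * (b i / (b i + r j))) t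
    have hstep : (fun ω => g (U.Bl (t + 1) ω) (U.Re (t + 1) ω)) =
        fun ω => (G * X) ω + g (U.Bl t ω) (U.Re t ω + 1) := by
      funext ω
      rcases U.step t ω with h | h
      · simp [hX, hG, h.1, h.2]
      · simp [hX, hG, h.1, h.2]
    have hpull : ∫ ω, (G * X) ω ∂μ = ∫ ω, (G * q) ω ∂μ := by
      rw [← integral_condExp (U.F_le t)]
      refine integral_congr_ae ?_
      refine (condExp_mul_of_stronglyMeasurable_left hGm hGXi hXi).trans ?_
      exact EventuallyEq.rfl.mul (U.markov t)
    rw [hstep, integral_add hGXi hRi, hpull, ← integral_add hGqi hRi]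
    refine integral_mono (hGqi.add hRi) (U.integrable_comp g t) fun ω => ?_
    have h0 : 0 < b (U.Bl t ω) + r (U.Re t ω) := add_pos (hb _) (hr _)
    have h1 := hg (U.Bl t ω) (U.Re t ω)
    rw [mul_comm (_ + _), ← div_le_iff₀ h0] at h1
    refine le_trans (le_of_eq ?_) h1
    simp only [Pi.mul_apply, hG, hq]
    field_simp
    ring

lemma measure_le_of_urnSuperharmonic [IsProbabilityMeasure μ] (U : Urn μ b r)
    (hb : ∀ i, 0 < b i) (hr : ∀ i, 0 < r i) {g : ℕ → ℕ → ℝ} (hg : UrnSuperharmonic b r g)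
    (hg0 : ∀ i j, 0 ≤ g i j) (hg1 : g 0 0 = 1) {K : ℝ} (hK : 0 < K) (t : ℕ) {S : Set Ω}
    (hS : ∀ ω ∈ S, 1 ≤ K * g (U.Bl t ω) (U.Re t ω)) :
    μ S ≤ ENNReal.ofReal K := by
  have h1 := mul_meas_ge_le_integral_of_nonneg (μ := μ)
    (ae_of_all _ fun ω => hg0 (U.Bl t ω) (U.Re t ω)) (U.integrable_comp g t) (1 / K)
  have h2 := h1.trans (U.integral_urnSuperharmonic_le hb hr hg t)
  rw [hg1, div_mul_eq_mul_div, one_mul, div_le_one hK] at h2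
  refine (measure_mono fun ω hω => ?_).trans
    ((ENNReal.le_ofReal_iff_toReal_le (measure_ne_top _ _) hK.le).mpr h2)
  rw [Set.mem_ofPred_eq, div_le_iff₀ hK, mul_comm]
  exact hS ω hω

lemma Bl_tau_of_unbounded (U : Urn μ b r) {ω : Ω} (h : ∀ p, ∃ t, p < U.Bl t ω) (k : ℕ) :
    U.Bl (U.tau k ω) ω = k := by
  induction k with
  | zero => simp [tau, U.init_Bl]
  | succ k ih =>
    set S : Set ℕ := {n : ℕ | U.tau k ω < n ∧ U.Bl n ω = U.Bl (n - 1) ω + 1} with hS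
    have hconst : ∀ s, (∀ n ≤ s, n ∉ S) → U.tau k ω ≤ s → U.Bl s ω = k := by
      intro s hs hks
      induction s, hks using Nat.le_induction with
      | base => exact ih
      | succ s hks ihs =>
        have h1 := ihs fun n hn => hs n (by omega)
        have h2 := hs (s + 1) le_rfl
        rcases U.step s ω with h3 | h3
        · exact absurd ⟨by omega, h3.1⟩ h2
        · rw [h3.1, h1]
    have hne : S.Nonempty := by
      by_contra hemp
      rw [Set.not_nonempty_iff_eq_empty] at hemp
      obtain ⟨t, ht⟩ := h k
      have h1 := hconst (max t (U.tau k ω)) (by simp [hemp]) (le_max_right _ _)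
      have h2 := U.Bl_mono ω (le_max_left t (U.tau k ω))
      dsimp only at h2
      omega
    have hmem : sInf S ∈ S := Nat.sInf_mem hne
    have hprev : U.Bl (sInf S - 1) ω = k := by
      have := hmem.1
      exact hconst _ (fun n hn => Nat.notMem_of_lt_sInf (by omega)) (by omega)
    change U.Bl (sInf S) ω = k + 1
    rw [hmem.2, hprev]

end Urn

lemma tail_rate_le {C C' c c' : ℝ} (hC : 0 < C) (hCC : C ≤ C') (hc : 0 < c') (hcc : 2 * c' ≤ c)
    {m n q : ℕ} (hm : 1 ≤ m) (hq : 1 ≤ q) (h : q ≤ 2 * max m n) :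
    C * Real.exp (-c * (m : ℝ) ^ 2 / (q : ℝ)) ≤
      C' * Real.exp (-c' * (m : ℝ) ^ 2 / max (m : ℝ) (n : ℝ)) := by
  have hm' : (0 : ℝ) < m := by exact_mod_cast hm
  have hq' : (0 : ℝ) < q := by exact_mod_cast hq
  have h' : (q : ℝ) ≤ 2 * max (m : ℝ) (n : ℝ) := by exact_mod_cast h
  refine mul_le_mul hCC (Real.exp_le_exp.mpr ?_) (Real.exp_pos _).le (hC.le.trans hCC)
  have hM : (0 : ℝ) < max (m : ℝ) (n : ℝ) := lt_max_of_lt_left hm'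
  rw [neg_mul, neg_mul, neg_div, neg_div, neg_le_neg_iff, div_le_div_iff₀ hM hq']
  calc c' * (m : ℝ) ^ 2 * q ≤ c' * (m : ℝ) ^ 2 * (2 * max (m : ℝ) (n : ℝ)) := by gcongr
    _ = 2 * c' * ((m : ℝ) ^ 2 * max (m : ℝ) (n : ℝ)) := by ring
    _ ≤ c * ((m : ℝ) ^ 2 * max (m : ℝ) (n : ℝ)) := by gcongr
    _ = _ := by ring

/-- Both one-sided tails of an urn, at the deterministic time when one colour must have won. -/
lemma Urn.exists_measure_le {Ω : Type*} [MeasurableSpace Ω] {μ : Measure Ω}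
    [IsProbabilityMeasure μ] {b r : ℕ → ℝ} (U : Urn μ b r)
    (hb : ∀ i, 0 < b i) (hr : ∀ i, 0 < r i) {α a A : ℝ} (hα : 0 < α) (ha : 0 < a) (hA : 0 < A)
    (h : RatesComparable b r α a A) :
    ∃ C > (0 : ℝ), ∃ c > (0 : ℝ), ∀ p m : ℕ, 1 ≤ m → ∀ n : ℕ, p + m ≤ 2 * max m n →
      μ {ω | U.Bl (p + (p + m)) ω ≤ p} ≤
        ENNReal.ofReal (C * Real.exp (-c * (m : ℝ) ^ 2 / max (m : ℝ) (n : ℝ))) ∧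
      μ {ω | U.Re (p + (p + m)) ω ≤ p} ≤
        ENNReal.ofReal (C * Real.exp (-c * (m : ℝ) ^ 2 / max (m : ℝ) (n : ℝ))) := by
  obtain ⟨C₁, hC₁, c₁, hc₁, H₁⟩ := exists_urnSuperharmonic hb hr hα ha hA h
  obtain ⟨C₂, hC₂, c₂, hc₂, H₂⟩ := exists_urnSuperharmonic hr hb hα ha hA h.symm
  refine ⟨max C₁ C₂, lt_max_of_lt_left hC₁, min c₁ c₂ / 2, by positivity,
    fun p m hm n hn => ⟨?_, ?_⟩⟩
  · obtain ⟨g, hg0, hg1, hg, hgK⟩ := H₁ p m hm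
    refine (U.measure_le_of_urnSuperharmonic hb hr hg hg0 hg1 (by positivity) (p + (p + m))
      fun ω hω => hgK _ _ hω ?_).trans (ENNReal.ofReal_le_ofReal (tail_rate_le hC₁
        (le_max_left _ _) (by positivity) (by linarith [min_le_left c₁ c₂]) hm (by omega) hn))
    have hω : U.Bl (p + (p + m)) ω ≤ p := hω
    have := U.Bl_add_Re (p + (p + m)) ω
    omega
  · obtain ⟨g, hg0, hg1, hg, hgK⟩ := H₂ p m hm
    refine (U.measure_le_of_urnSuperharmonic hb hr (g := fun i j => g j i) (fun i j => ?_)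
      (fun i j => hg0 j i) hg1 (by positivity) (p + (p + m))
      fun ω hω => hgK _ _ hω ?_).trans (ENNReal.ofReal_le_ofReal (tail_rate_le hC₂
        (le_max_right _ _) (by positivity) (by linarith [min_le_right c₁ c₂]) hm (by omega) hn))
    · have := hg j i
      rwa [add_comm, add_comm (b i)]
    · have hω : U.Re (p + (p + m)) ω ≤ p := hω
      have := U.Bl_add_Re (p + (p + m)) ω
      omega

/-- Blue is almost surely drawn infinitely often. -/
lemma Urn.measure_Bl_bounded {Ω : Type*} [MeasurableSpace Ω] {μ : Measure Ω}
    [IsProbabilityMeasure μ] {b r : ℕ → ℝ} (U : Urn μ b r)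
    (hb : ∀ i, 0 < b i) (hr : ∀ i, 0 < r i) {α a A : ℝ} (hα : 0 < α) (ha : 0 < a) (hA : 0 < A)
    (h : RatesComparable b r α a A) :
    μ {ω | ¬ ∀ p, ∃ t, p < U.Bl t ω} = 0 := by
  obtain ⟨C, hC, c, hc, H⟩ := U.exists_measure_le hb hr hα ha hA h
  have hset : {ω | ¬ ∀ p, ∃ t, p < U.Bl t ω} = ⋃ p, {ω | ∀ t, U.Bl t ω ≤ p} := by
    ext ω; simp
  rw [hset]
  refine measure_iUnion_null fun p => le_antisymm ?_ zero_le
  have hlim : Tendsto (fun m : ℕ => ENNReal.ofReal (C * Real.exp (-c * (m : ℝ)))) atTop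
      (nhds 0) := by
    rw [← ENNReal.ofReal_zero]
    refine ENNReal.tendsto_ofReal ?_
    rw [← mul_zero C]
    refine (Real.tendsto_exp_atBot.comp ?_).const_mul C
    exact tendsto_natCast_atTop_atTop.const_mul_atTop_of_neg (by linarith)
  refine ge_of_tendsto hlim ?_
  filter_upwards [eventually_ge_atTop (max 1 p)] with m hm
  have hm1 : 1 ≤ m := (le_max_left _ _).trans hm
  have hpm : p ≤ m := (le_max_right _ _).trans hm
  refine (measure_mono fun ω hω => ?_).trans
    ((H p m hm1 m (by rw [max_self]; omega)).1.trans (le_of_eq ?_))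
  · exact hω (p + (p + m))
  · have : (m : ℝ) ≠ 0 := by positivity
    rw [max_self]
    congr 3
    field_simp

theorem discrepancy_tail_at_tau {Ω : Type*} [MeasurableSpace Ω] (μ : MeasureTheory.Measure Ω) [MeasureTheory.IsProbabilityMeasure μ]
    (α B : ℝ) (hα : 0 < α) (w : ℕ → ℝ) (hw : ∀ n, 0 < w n)
    (hasymp : WeightAsymp w α B)
    (b r : ℕ → ℝ) (hb : ∀ i, 0 < b i) (hr : ∀ i, 0 < r i)
    (hchoice : UrnChoice w b r) (U : Urn μ b r) :
    ∃ C₁ > (0:ℝ), ∃ c₁ > (0:ℝ), ∀ n : ℕ, 1 ≤ n → ∀ m : ℕ, 1 ≤ m →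
      μ {ω | (m : ℤ) ≤ |U.D (U.tau n ω) ω|} ≤
        ENNReal.ofReal (C₁ * Real.exp (-c₁ * (m:ℝ)^2 / max (m:ℝ) (n:ℝ))) := by
  obtain ⟨a, ha, A, hA, hcomp⟩ := hchoice.exists_ratesComparable hα hw hasymp
  obtain ⟨C, hC, c, hc, H⟩ := U.exists_measure_le hb hr hα ha hA hcomp
  refine ⟨2 * C, by positivity, c, hc, fun n _ m hm => ?_⟩
  set E : ℝ := C * Real.exp (-c * (m : ℝ) ^ 2 / max (m : ℝ) (n : ℝ)) with hE
  have hE0 : 0 ≤ E := by positivity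
  have hred := (H n m hm n (by omega)).1
  have hblue : μ {ω | m ≤ n ∧ U.Re (n - m + (n - m + m)) ω ≤ n - m} ≤ ENNReal.ofReal E := by
    by_cases hmn : m ≤ n
    · simp only [hmn, true_and]
      exact (H (n - m) m hm n (by omega)).2
    · simp [hmn]
  have hsub : {ω | (m : ℤ) ≤ |U.D (U.tau n ω) ω|} ⊆
      {ω | ¬ ∀ p, ∃ t, p < U.Bl t ω} ∪ ({ω | U.Bl (n + (n + m)) ω ≤ n} ∪
        {ω | m ≤ n ∧ U.Re (n - m + (n - m + m)) ω ≤ n - m}) := by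
    intro ω hω
    by_cases hub : ∀ p, ∃ t, p < U.Bl t ω
    · right
      have hB := U.Bl_tau_of_unbounded hub n
      have hT := U.Bl_add_Re (U.tau n ω) ω
      rw [Set.mem_ofPred_eq, Urn.D, hB] at hω
      rcases le_abs.mp hω with h | h
      · left
        have := U.Bl_mono ω (show n + (n + m) ≤ U.tau n ω by omega)
        dsimp only at this
        rw [Set.mem_ofPred_eq]
        omega
      · right
        have hmn : m ≤ n := by omega
        refine ⟨hmn, ?_⟩
        by_contra hcon
        have h1 := U.Bl_add_Re (n - m + (n - m + m)) ω
        by_cases hle : U.tau n ω ≤ n - m + (n - m + m)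
        · have := U.Bl_mono ω hle
          dsimp only at this
          omega
        · omega
    · exact Or.inl hub
  calc μ {ω | (m : ℤ) ≤ |U.D (U.tau n ω) ω|}
      ≤ 0 + (ENNReal.ofReal E + ENNReal.ofReal E) := by
        refine (measure_mono hsub).trans ((measure_union_le _ _).trans ?_)
        refine add_le_add (U.measure_Bl_bounded hb hr hα ha hA hcomp).le ?_
        exact (measure_union_le _ _).trans (add_le_add hred hblue)
    _ = ENNReal.ofReal (2 * C * Real.exp (-c * (m : ℝ) ^ 2 / max (m : ℝ) (n : ℝ))) := by
        rw [zero_add, ← ENNReal.ofReal_add hE0 hE0, hE]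
        congr 1
        ring
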